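/- Let J₀ : ℝ → ℝ be defined by J₀(z) = (1/π) ∫₀^π cos(z sin θ) dθ, let Y₀ : (0,∞) → ℝ be defined by Y₀(z) = −(2/π) ∫₀^∞ cos(z cosh t) dt, and set H₀⁻(z) = J₀(z) − i Y₀(z) for z > 0. Let λ₁ ∈ (0, 1/4] and let χ : ℝ → [0,1] be a smooth function with χ(λ) = 1 for 0 ≤ λ ≤ λ₁ and χ(λ) = 0 for λ ≥ 2λ₁. Then there exists a constant C (depending on χ) such that for all fixed constants r, s > 0: |∫₀^∞ (H₀⁻)′(λr) · J₀′(λs) · λ · χ(λ) dλ| ≤ C · s · (1 + log⟨r⟩) / (r · ⟨r + s⟩ · ⟨r − s⟩). -/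

import Mathlib

open MeasureTheory Real Filter

/-- The Bessel function of the first kind of order zero,
`J₀(z) = (1/π) ∫₀^π cos(z sin θ) dθ`. -/
noncomputable def J0 (z : ℝ) : ℝ :=
  (1 / Real.pi) * ∫ θ in (0:ℝ)..Real.pi, Real.cos (z * Real.sin θ)

lemma hasDerivAt_integral_mul_cos {f k : ℝ → ℝ} (hf : Continuous f) (hk : Continuous k)
    (a b z : ℝ) :
    HasDerivAt (fun z => ∫ t in a..b, f t * cos (z * k t))
      (∫ t in a..b, -(f t * k t * sin (z * k t))) z := by
  refine (intervalIntegral.hasDerivAt_integral_of_dominated_loc_of_deriv_le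
    (bound := fun t => |f t * k t|) (F' := fun z t => -(f t * k t * sin (z * k t)))
    Filter.univ_mem
    (.of_forall fun x => (by fun_prop : Continuous _).aestronglyMeasurable)
    ((by fun_prop : Continuous _).intervalIntegrable _ _)
    (by fun_prop : Continuous _).aestronglyMeasurable
    (.of_forall fun t _ x _ => ?_) ((by fun_prop : Continuous _).intervalIntegrable _ _)
    (.of_forall fun t _ x _ => ?_)).2
  · rw [norm_neg, norm_mul, Real.norm_eq_abs, Real.norm_eq_abs]
    exact mul_le_of_le_one_right (abs_nonneg _) (abs_sin_le_one _)
  · have := ((((hasDerivAt_id x).mul_const (k t)).cos).const_mul (f t))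
    exact this.congr_deriv (by simp only [id_eq]; ring)

lemma hasDerivAt_integral_mul_sin {f k : ℝ → ℝ} (hf : Continuous f) (hk : Continuous k)
    (a b z : ℝ) :
    HasDerivAt (fun z => ∫ t in a..b, f t * sin (z * k t))
      (∫ t in a..b, f t * k t * cos (z * k t)) z := by
  refine (intervalIntegral.hasDerivAt_integral_of_dominated_loc_of_deriv_le
    (bound := fun t => |f t * k t|) (F' := fun z t => f t * k t * cos (z * k t))
    Filter.univ_mem
    (.of_forall fun x => (by fun_prop : Continuous _).aestronglyMeasurable)
    ((by fun_prop : Continuous _).intervalIntegrable _ _)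
    (by fun_prop : Continuous _).aestronglyMeasurable
    (.of_forall fun t _ x _ => ?_) ((by fun_prop : Continuous _).intervalIntegrable _ _)
    (.of_forall fun t _ x _ => ?_)).2
  · rw [norm_mul, Real.norm_eq_abs, Real.norm_eq_abs]
    exact mul_le_of_le_one_right (abs_nonneg _) (abs_cos_le_one _)
  · have := ((((hasDerivAt_id x).mul_const (k t)).sin).const_mul (f t))
    exact this.congr_deriv (by simp only [id_eq]; ring)

/-- `w` solves Bessel's equation of order zero on `(0, ∞)` and `A` is its derivative there. -/
def IsBesselSolution (w A : ℝ → ℝ) : Prop :=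
  ∀ x, 0 < x → HasDerivAt w (A x) x ∧ HasDerivAt A (-(A x) / x - w x) x

/-- The derivative of `J0`. -/
noncomputable def J0deriv (z : ℝ) : ℝ :=
  (1 / π) * ∫ θ in (0:ℝ)..π, -(sin θ * sin (z * sin θ))

/-- The second derivative of `J0`. -/
noncomputable def J0deriv2 (z : ℝ) : ℝ :=
  (1 / π) * ∫ θ in (0:ℝ)..π, -(sin θ * sin θ * cos (z * sin θ))

lemma hasDerivAt_J0 (z : ℝ) : HasDerivAt J0 (J0deriv z) z := by
  have := (hasDerivAt_integral_mul_cos (f := fun _ => 1) continuous_const continuous_sin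
    0 π z).const_mul (1 / π)
  simp only [one_mul] at this
  exact this

lemma hasDerivAt_J0deriv (z : ℝ) : HasDerivAt J0deriv (J0deriv2 z) z := by
  have := (hasDerivAt_integral_mul_sin (f := fun θ => -sin θ) continuous_sin.neg continuous_sin
    0 π z).const_mul (1 / π)
  simp only [neg_mul] at this
  exact this

lemma bessel_equation_J0 (z : ℝ) : z * J0deriv2 z + J0deriv z + z * J0 z = 0 := by
  have h : ∫ θ in (0:ℝ)..π, (z * (-(sin θ * sin θ * cos (z * sin θ)))
      + -(sin θ * sin (z * sin θ)) + z * cos (z * sin θ)) = 0 := by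
    have := intervalIntegral.integral_eq_sub_of_hasDerivAt (a := 0) (b := π)
      (f := fun θ => cos θ * sin (z * sin θ))
      (f' := fun θ => z * (-(sin θ * sin θ * cos (z * sin θ)))
        + -(sin θ * sin (z * sin θ)) + z * cos (z * sin θ)) (fun θ _ => ?_)
      ((by fun_prop : Continuous _).intervalIntegrable _ _)
    · simpa using this
    · have := (hasDerivAt_cos θ).mul (((hasDerivAt_sin θ).const_mul z).sin)
      refine this.congr_deriv ?_
      linear_combination (z * cos (z * sin θ)) * cos_sq_add_sin_sq θ
  rw [intervalIntegral.integral_add, intervalIntegral.integral_add,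
    intervalIntegral.integral_const_mul, intervalIntegral.integral_const_mul] at h
  · unfold J0deriv2 J0deriv J0
    linear_combination (1 / π) * h
  all_goals exact (by fun_prop : Continuous _).intervalIntegrable _ _

lemma isBesselSolution_J0 : IsBesselSolution J0 J0deriv := by
  refine fun x hx => ⟨hasDerivAt_J0 x, ?_⟩
  refine (hasDerivAt_J0deriv x).congr_deriv ?_
  have := bessel_equation_J0 x
  field_simp
  linarith

lemma abs_J0deriv_le (z : ℝ) : |J0deriv z| ≤ |z| := by
  have := intervalIntegral.norm_integral_le_of_norm_le_const (a := 0) (b := π) (C := |z|)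
    (f := fun θ => -(sin θ * sin (z * sin θ))) (fun θ _ => ?_)
  · rw [J0deriv, abs_mul, abs_of_pos (by positivity)]
    rw [sub_zero, abs_of_pos pi_pos, Real.norm_eq_abs] at this
    calc _ ≤ 1 / π * (|z| * π) := by gcongr
      _ = |z| := by field_simp
  · rw [norm_neg, norm_mul, Real.norm_eq_abs, Real.norm_eq_abs]
    have h1 := abs_sin_le_one θ
    have h2 : |sin (z * sin θ)| ≤ |z * sin θ| := abs_sin_le_abs
    rw [abs_mul] at h2
    have h3 := abs_nonneg (sin θ)
    have h4 := abs_nonneg z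
    nlinarith [mul_le_mul h1 h2 (abs_nonneg _) zero_le_one, mul_le_mul_of_nonneg_left h1 h4]

lemma abs_J0deriv2_le (z : ℝ) : |J0deriv2 z| ≤ 1 := by
  have := intervalIntegral.norm_integral_le_of_norm_le_const (a := 0) (b := π) (C := 1)
    (f := fun θ => -(sin θ * sin θ * cos (z * sin θ))) (fun θ _ => ?_)
  · rw [J0deriv2, abs_mul, abs_of_pos (by positivity)]
    rw [sub_zero, abs_of_pos pi_pos, Real.norm_eq_abs] at this
    calc _ ≤ 1 / π * (1 * π) := by gcongr
      _ = 1 := by field_simp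
  · rw [norm_neg, norm_mul, norm_mul, Real.norm_eq_abs, Real.norm_eq_abs]
    exact mul_le_one₀ (mul_le_one₀ (abs_sin_le_one θ) (abs_nonneg _) (abs_sin_le_one θ))
      (abs_nonneg _) (abs_cos_le_one _)

namespace IsBesselSolution

variable {w A : ℝ → ℝ}

lemma bound_of_le_one (h : IsBesselSolution w A) {x : ℝ} (hx : 0 < x) (hx1 : x ≤ 1) :
    x ^ 2 * (A x ^ 2 + w x ^ 2) ≤ A 1 ^ 2 + w 1 ^ 2 := by
  have hd : ∀ y, 0 < y →
      HasDerivAt (fun y => y ^ 2 * (A y ^ 2 + w y ^ 2)) (2 * y * w y ^ 2) y := by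
    intro y hy
    obtain ⟨h1, h2⟩ := h y hy
    refine HasDerivAt.congr_deriv (((hasDerivAt_id y).pow 2).mul ((h2.pow 2).add (h1.pow 2))) ?_
    simp
    field_simp
    ring
  have hm : MonotoneOn (fun y => y ^ 2 * (A y ^ 2 + w y ^ 2)) (Set.Ioi 0) := by
    apply monotoneOn_of_deriv_nonneg (convex_Ioi 0)
    · exact fun y hy => (hd y hy).continuousAt.continuousWithinAt
    · rw [interior_Ioi]
      exact fun y hy => (hd y hy).differentiableAt.differentiableWithinAt
    · rw [interior_Ioi]
      intro y (hy : 0 < y)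
      rw [(hd y hy).deriv]
      positivity
  simpa using hm hx (show (0:ℝ) < 1 by norm_num) hx1

lemma bound_of_one_le (h : IsBesselSolution w A) {x : ℝ} (hx : 1 ≤ x) :
    x * (A x ^ 2 + w x ^ 2) ≤ 4 * (A 1 ^ 2 + w 1 ^ 2) := by
  have hd : ∀ y, 0 < y →
      HasDerivAt (fun y => y * (A y ^ 2 + w y ^ 2) + A y * w y + w y ^ 2 / (2 * y))
        (-(w y ^ 2) / (2 * y ^ 2)) y := by
    intro y hy
    obtain ⟨h1, h2⟩ := h y hy
    refine HasDerivAt.congr_deriv ((((hasDerivAt_id y).mul ((h2.pow 2).add (h1.pow 2))).add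
      (h2.mul h1)).add ((h1.pow 2).div ((hasDerivAt_id y).const_mul 2) (by simp; positivity))) ?_
    simp
    field_simp
    ring
  have hm : AntitoneOn (fun y => y * (A y ^ 2 + w y ^ 2) + A y * w y + w y ^ 2 / (2 * y))
      (Set.Ioi 0) := by
    apply antitoneOn_of_deriv_nonpos (convex_Ioi 0)
    · exact fun y hy => (hd y hy).continuousAt.continuousWithinAt
    · rw [interior_Ioi]
      exact fun y hy => (hd y hy).differentiableAt.differentiableWithinAt
    · rw [interior_Ioi]
      intro y (hy : 0 < y)
      rw [(hd y hy).deriv, neg_div]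
      have : 0 ≤ w y ^ 2 / (2 * y ^ 2) := by positivity
      linarith
  have := hm (show (0:ℝ) < 1 by norm_num) (show 0 < x by linarith) hx
  simp only at this
  have h3 : 0 ≤ w x ^ 2 / (2 * x) := by positivity
  have h4 : 0 ≤ (x - 1) * (A x ^ 2 + w x ^ 2) := mul_nonneg (by linarith) (by positivity)
  nlinarith [sq_nonneg (A x + w x), sq_nonneg (A 1 - w 1), sq_nonneg (A 1), sq_nonneg (w 1)]

lemma exists_bound (h : IsBesselSolution w A) : ∃ K, 0 < K ∧
    (∀ x, 0 < x → |A x| ≤ K * (√(1 + x) / x)) ∧ (∀ x, 0 < x → x ≤ 1 → |w x| ≤ K / x) ∧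
    (∀ x, 1 ≤ x → |A x| ≤ K / √(1 + x)) ∧ (∀ x, 1 ≤ x → |w x| ≤ K / √(1 + x)) := by
  set M := A 1 ^ 2 + w 1 ^ 2 with hM
  have hM0 : 0 ≤ M := by positivity
  have hK : (√(8 * M + 1)) ^ 2 = 8 * M + 1 := sq_sqrt (by positivity)
  have key : ∀ x, 1 ≤ x → ∀ a : ℝ, x * a ^ 2 ≤ 4 * M → |a| ≤ √(8 * M + 1) / √(1 + x) := by
    intro x hx a ha
    rw [← sqrt_div (by positivity)]
    apply abs_le_sqrt
    rw [le_div_iff₀ (by positivity)]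
    nlinarith [sq_nonneg a]
  have key2 : ∀ x, 0 < x → ∀ a : ℝ, x ^ 2 * a ^ 2 ≤ M → |a| ≤ √(8 * M + 1) / x := by
    intro x hx a ha
    rw [le_div_iff₀ hx, show |a| * x = |a * x| by rw [abs_mul, abs_of_pos hx]]
    apply abs_le_sqrt
    nlinarith
  have far : ∀ x, 1 ≤ x → |A x| ≤ √(8 * M + 1) / √(1 + x) ∧
      |w x| ≤ √(8 * M + 1) / √(1 + x) := by
    intro x hx
    have := h.bound_of_one_le hx
    exact ⟨key x hx _ (by nlinarith [sq_nonneg (w x)]), key x hx _ (by nlinarith [sq_nonneg (A x)])⟩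
  have near : ∀ x, 0 < x → x ≤ 1 → |A x| ≤ √(8 * M + 1) / x ∧ |w x| ≤ √(8 * M + 1) / x := by
    intro x hx hx1
    have := h.bound_of_le_one hx hx1
    exact ⟨key2 x hx _ (by nlinarith [mul_nonneg (sq_nonneg x) (sq_nonneg (w x))]),
      key2 x hx _ (by nlinarith [mul_nonneg (sq_nonneg x) (sq_nonneg (A x))])⟩
  refine ⟨√(8 * M + 1), by positivity, fun x hx => ?_, fun x hx hx1 => (near x hx hx1).2,
    fun x hx => (far x hx).1, fun x hx => (far x hx).2⟩
  rw [← mul_div_assoc]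
  rcases le_total x 1 with hx1 | hx1
  · refine (near x hx hx1).1.trans ?_
    gcongr
    exact le_mul_of_one_le_right (by positivity) (one_le_sqrt.2 (by linarith))
  · refine (far x hx1).1.trans ?_
    rw [div_le_div_iff₀ (by positivity) hx, mul_assoc, mul_self_sqrt (by positivity)]
    gcongr
    linarith

end IsBesselSolution

lemma exists_bound_J0deriv : ∃ K, 0 < K ∧
    (∀ x, 0 < x → |J0deriv x| ≤ K * (x / ((1 + x) * √(1 + x)))) ∧
    (∀ x, 0 < x → |J0deriv2 x| ≤ K / √(1 + x)) := by
  obtain ⟨K, hK, -, -, hA, hw⟩ := isBesselSolution_J0.exists_bound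
  have h2 : ∀ x : ℝ, 0 < x → x ≤ 1 → √(1 + x) ≤ 2 := fun x hx hx1 => by
    rw [sqrt_le_left (by norm_num)]; linarith
  refine ⟨2 * K + 4, by positivity, fun x hx => ?_, fun x hx => ?_⟩
  · rcases le_total x 1 with hx1 | hx1
    · refine (abs_J0deriv_le x).trans ?_
      rw [abs_of_pos hx, ← mul_div_assoc, le_div_iff₀ (by positivity)]
      have := h2 x hx hx1
      have : (1 + x) * √(1 + x) ≤ 2 * 2 := by gcongr; linarith
      nlinarith
    · refine (hA x hx1).trans ?_
      rw [← mul_div_assoc, div_le_div_iff₀ (by positivity) (by positivity), ← mul_assoc]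
      exact mul_le_mul_of_nonneg_right (by nlinarith) (sqrt_nonneg _)
  · rcases le_total x 1 with hx1 | hx1
    · refine (abs_J0deriv2_le x).trans ?_
      rw [le_div_iff₀ (by positivity)]
      have := h2 x hx hx1
      linarith
    · have h3 : J0deriv2 x = -(J0deriv x) / x - J0 x := by
        have := bessel_equation_J0 x
        field_simp
        linarith
      rw [h3]
      have h4 : |-(J0deriv x) / x| ≤ |J0deriv x| := by
        rw [abs_div, abs_neg, abs_of_pos hx]
        exact div_le_self (abs_nonneg _) hx1
      calc _ ≤ |-(J0deriv x) / x| + |J0 x| := abs_sub _ _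
        _ ≤ K / √(1 + x) + K / √(1 + x) := add_le_add (h4.trans (hA x hx1)) (hw x hx1)
        _ = 2 * K / √(1 + x) := by ring
        _ ≤ _ := by gcongr; linarith

lemma abs_integral_cos_mul_cosh_le {z S T : ℝ} (hz : 0 < z) (hS : 0 < S) (hST : S ≤ T) :
    |∫ t in S..T, cos (z * cosh t)| ≤ 2 / (z * sinh S) := by
  have hpos : ∀ t ∈ Set.uIcc S T, 0 < sinh t := fun t ht => by
    rw [Set.uIcc_of_le hST] at ht
    exact sinh_pos_iff.2 (hS.trans_le ht.1)
  have hc1 : ContinuousOn (fun t => cosh t / (z * sinh t ^ 2)) (Set.uIcc S T) :=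
    ContinuousOn.div (by fun_prop) (by fun_prop) fun t ht => by have := hpos t ht; positivity
  have hc2 : ContinuousOn (fun t => sin (z * cosh t) * (cosh t / (z * sinh t ^ 2)))
      (Set.uIcc S T) := ContinuousOn.mul (by fun_prop) hc1
  have hi1 : IntervalIntegrable (fun t => cos (z * cosh t)) volume S T :=
    (by fun_prop : Continuous _).intervalIntegrable _ _
  have h1 := intervalIntegral.integral_eq_sub_of_hasDerivAt (a := S) (b := T)
    (f := fun t => sin (z * cosh t) / (z * sinh t))
    (f' := fun t => cos (z * cosh t) - sin (z * cosh t) * (cosh t / (z * sinh t ^ 2)))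
    (fun t ht => by
      have := hpos t ht
      refine HasDerivAt.congr_deriv ((((hasDerivAt_cosh t).const_mul z).sin).div
        ((hasDerivAt_sinh t).const_mul z) (by positivity)) ?_
      field_simp) (hi1.sub hc2.intervalIntegrable)
  rw [intervalIntegral.integral_sub hi1 hc2.intervalIntegrable] at h1
  have h2 := intervalIntegral.integral_eq_sub_of_hasDerivAt (a := S) (b := T)
    (f := fun t => -(1 / (z * sinh t))) (f' := fun t => cosh t / (z * sinh t ^ 2))
    (fun t ht => by
      have := hpos t ht
      refine HasDerivAt.congr_deriv ((hasDerivAt_const t (1:ℝ)).div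
        ((hasDerivAt_sinh t).const_mul z) (by positivity)).neg ?_
      field_simp
      ring) hc1.intervalIntegrable
  have h3 := intervalIntegral.norm_integral_le_of_norm_le (μ := volume) hST
    (f := fun t => sin (z * cosh t) * (cosh t / (z * sinh t ^ 2)))
    (.of_forall fun t ht => by
      rw [norm_mul, Real.norm_eq_abs, Real.norm_eq_abs,
        abs_of_nonneg (a := cosh t / _) (by have := cosh_pos t; positivity)]
      exact mul_le_of_le_one_left (by have := cosh_pos t; positivity) (abs_sin_le_one _))
    hc1.intervalIntegrable
  rw [h2, Real.norm_eq_abs] at h3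
  have hb : ∀ t ∈ Set.uIcc S T, |sin (z * cosh t) / (z * sinh t)| ≤ 1 / (z * sinh t) := by
    intro t ht
    have := hpos t ht
    rw [abs_div, abs_of_pos (a := z * sinh t) (by positivity)]
    gcongr
    exact abs_sin_le_one _
  have hbS := hb S Set.left_mem_uIcc
  have hbT := hb T Set.right_mem_uIcc
  rw [show 2 / (z * sinh S) = 1 / (z * sinh S) + 1 / (z * sinh S) by ring]
  rw [abs_le] at *
  constructor <;> linarith

/-- The truncated integral `∫₀ᵀ cos (z cosh t) dt`. -/
noncomputable def coshIntegral (T z : ℝ) : ℝ := ∫ t in (0:ℝ)..T, cos (z * cosh t)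

/-- The derivative of `coshIntegral T`. -/
noncomputable def coshIntegralDeriv (T z : ℝ) : ℝ :=
  ∫ t in (0:ℝ)..T, -(cosh t * sin (z * cosh t))

lemma hasDerivAt_coshIntegral (T z : ℝ) :
    HasDerivAt (coshIntegral T) (coshIntegralDeriv T z) z := by
  have := hasDerivAt_integral_mul_cos (f := fun _ => 1) continuous_const continuous_cosh 0 T z
  simp only [one_mul] at this
  exact this

lemma continuous_coshIntegral (T : ℝ) : Continuous (coshIntegral T) :=
  continuous_iff_continuousAt.2 fun z => (hasDerivAt_coshIntegral T z).continuousAt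

lemma hasDerivAt_mul_coshIntegralDeriv (T z : ℝ) :
    HasDerivAt (fun z => z * coshIntegralDeriv T z)
      (-(z * coshIntegral T z) - sinh T * sin (z * cosh T)) z := by
  have h1 := hasDerivAt_integral_mul_sin (f := fun t => -cosh t) continuous_cosh.neg
    continuous_cosh 0 T z
  simp only [neg_mul] at h1
  refine HasDerivAt.congr_deriv ((hasDerivAt_id z).mul h1) ?_
  have h2 := intervalIntegral.integral_eq_sub_of_hasDerivAt (a := 0) (b := T)
    (f := fun t => sinh t * sin (z * cosh t))
    (f' := fun t => z * (cosh t * cosh t * cos (z * cosh t)) + cosh t * sin (z * cosh t)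
      - z * cos (z * cosh t)) (fun t _ => by
      refine HasDerivAt.congr_deriv
        ((hasDerivAt_sinh t).mul (((hasDerivAt_cosh t).const_mul z).sin)) ?_
      linear_combination (-z * cos (z * cosh t)) * cosh_sq_sub_sinh_sq t)
    ((by fun_prop : Continuous _).intervalIntegrable _ _)
  rw [intervalIntegral.integral_sub, intervalIntegral.integral_add,
    intervalIntegral.integral_const_mul, intervalIntegral.integral_const_mul] at h2
  · simp only [sinh_zero, zero_mul, sub_zero] at h2
    simp only [intervalIntegral.integral_neg, id_eq, coshIntegral, coshIntegralDeriv]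
    linarith
  all_goals exact (by fun_prop : Continuous _).intervalIntegrable _ _

/-- The flux `z ∂_z ∫₀ᵀ cos (z cosh t) dt`, corrected so as to converge as `T → ∞`. -/
noncomputable def coshFlux (T z : ℝ) : ℝ :=
  z * coshIntegralDeriv T z - sinh T / cosh T * cos (z * cosh T)

lemma hasDerivAt_coshFlux (T z : ℝ) :
    HasDerivAt (coshFlux T) (-(z * coshIntegral T z)) z := by
  have hc := cosh_pos T
  refine HasDerivAt.congr_deriv ((hasDerivAt_mul_coshIntegralDeriv T z).sub
    ((((hasDerivAt_id z).mul_const (cosh T)).cos).const_mul (sinh T / cosh T))) ?_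
  simp only [id_eq]
  field_simp
  ring

lemma hasDerivAt_coshIntegral_sub (T : ℝ) {z : ℝ} (hz : 0 < z) :
    HasDerivAt (fun z => coshIntegral T z - sinh T / cosh T * (sin (z * cosh T) / (z * cosh T)))
      (coshFlux T z / z + sinh T / cosh T * (sin (z * cosh T) / (z ^ 2 * cosh T))) z := by
  have hc := cosh_pos T
  refine HasDerivAt.congr_deriv ((hasDerivAt_coshIntegral T z).sub
    (((((hasDerivAt_id z).mul_const (cosh T)).sin).div ((hasDerivAt_id z).mul_const (cosh T))
      (by simp; exact ⟨hz.ne', hc.ne'⟩)).const_mul (sinh T / cosh T))) ?_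
  simp only [id_eq, coshFlux]
  field_simp
  ring

lemma uIcc_one_subset {z : ℝ} (hz : 0 < z) : Set.uIcc 1 z ⊆ Set.Ioi 0 := fun y hy => by
  rw [Set.mem_uIcc] at hy
  rcases hy with h | h
  · exact one_pos.trans_le h.1
  · exact hz.trans_le h.1

lemma coshFlux_eq (T y : ℝ) :
    coshFlux T y = coshFlux T 1 - ∫ x in (1:ℝ)..y, x * coshIntegral T x := by
  have := intervalIntegral.integral_eq_sub_of_hasDerivAt (a := 1) (b := y)
    (fun x _ => hasDerivAt_coshFlux T x)
    ((continuous_id.mul (continuous_coshIntegral T)).neg.intervalIntegrable _ _)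
  rw [intervalIntegral.integral_neg] at this
  linarith

lemma abs_sinh_div_cosh_le (T : ℝ) : |sinh T / cosh T| ≤ 1 := by
  rw [abs_div, abs_of_pos (cosh_pos T), div_le_one (cosh_pos T)]
  exact abs_le_of_sq_le_sq (by linarith [cosh_sq_sub_sinh_sq T]) (cosh_pos T).le

section

variable {G : ℝ → ℝ}

lemma abs_coshIntegral_sub_le
    (hG : ∀ z, 0 < z → Tendsto (fun T => coshIntegral T z) atTop (nhds (G z)))
    {S z : ℝ} (hS : 0 < S) (hz : 0 < z) :
    |coshIntegral S z - G z| ≤ 2 / (z * sinh S) := by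
  rw [abs_sub_comm]
  refine le_of_tendsto ((hG z hz).sub_const (coshIntegral S z)).abs ?_
  filter_upwards [eventually_ge_atTop S] with T hT
  have : coshIntegral T z - coshIntegral S z = ∫ t in S..T, cos (z * cosh t) :=
    intervalIntegral.integral_interval_sub_left
      ((by fun_prop : Continuous _).intervalIntegrable _ _)
      ((by fun_prop : Continuous _).intervalIntegrable _ _)
  rw [this]
  exact abs_integral_cos_mul_cosh_le hz hS hT

lemma tendsto_sinh_atTop : Tendsto sinh atTop atTop := by
  refine tendsto_atTop_mono' _ ?_ tendsto_id
  filter_upwards [eventually_ge_atTop 0] with t ht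
  exact self_le_sinh_iff.2 ht

lemma continuousOn_of_tendsto_coshIntegral
    (hG : ∀ z, 0 < z → Tendsto (fun T => coshIntegral T z) atTop (nhds (G z))) :
    ContinuousOn G (Set.Ioi 0) := by
  intro z (hz : 0 < z)
  have hu : TendstoUniformlyOn coshIntegral G atTop (Set.Ioi (z / 2)) := by
    rw [Metric.tendstoUniformlyOn_iff]
    intro ε hε
    have hlim : Tendsto (fun T => 2 / (z / 2 * sinh T)) atTop (nhds 0) :=
      (tendsto_sinh_atTop.const_mul_atTop (by positivity)).const_div_atTop 2
    filter_upwards [hlim.eventually_lt_const hε, eventually_gt_atTop 0] with T hT hT0 x hx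
    have hx' : z / 2 < x := hx
    have := sinh_pos_iff.2 hT0
    rw [dist_comm, Real.dist_eq]
    refine (abs_coshIntegral_sub_le hG hT0 (by linarith)).trans_lt (lt_of_le_of_lt ?_ hT)
    gcongr
  have := hu.continuousOn (Frequently.of_forall fun T => (continuous_coshIntegral T).continuousOn)
  exact (this.continuousAt (Ioi_mem_nhds (by linarith))).continuousWithinAt

/-- The primitive of `x ↦ x * G x` vanishing at `1`. -/
noncomputable def momentPrimitive (G : ℝ → ℝ) (y : ℝ) : ℝ := ∫ x in (1:ℝ)..y, x * G x

lemma hasDerivAt_momentPrimitive (hG : ContinuousOn G (Set.Ioi 0)) {y : ℝ} (hy : 0 < y) :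
    HasDerivAt (momentPrimitive G) (y * G y) y := by
  have hc : ContinuousOn (fun x => x * G x) (Set.Ioi 0) := continuousOn_id.mul hG
  exact intervalIntegral.integral_hasDerivAt_right
    (hc.mono (uIcc_one_subset hy)).intervalIntegrable
    (hc.stronglyMeasurableAtFilter isOpen_Ioi _ hy) (hc.continuousAt (Ioi_mem_nhds hy))

lemma tendsto_coshFlux_mul_log
    (hG : ∀ z, 0 < z → Tendsto (fun T => coshIntegral T z) atTop (nhds (G z)))
    {z : ℝ} (hz : 0 < z) :
    Tendsto (fun T => coshFlux T 1 * log z) atTop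
      (nhds (G z - G 1 + ∫ y in (1:ℝ)..z, momentPrimitive G y / y)) := by
  have hGc := continuousOn_of_tendsto_coshIntegral hG
  have hsub := uIcc_one_subset hz
  have hpos : ∀ y ∈ Set.uIcc 1 z, 0 < y := fun y hy => hsub hy
  have hGi : ∀ y, 0 < y → IntervalIntegrable (fun x => x * G x) volume 1 y := fun y hy =>
    ((continuousOn_id.mul hGc).mono (uIcc_one_subset hy)).intervalIntegrable
  have hTi : ∀ T a b, IntervalIntegrable (fun x => x * coshIntegral T x) volume a b := fun T a b =>
    (continuous_id.mul (continuous_coshIntegral T)).intervalIntegrable _ _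
  have hNi : IntervalIntegrable (fun y => momentPrimitive G y / y) volume 1 z :=
    ContinuousOn.intervalIntegrable (ContinuousOn.div (fun y hy =>
      (hasDerivAt_momentPrimitive hGc (hpos y hy)).continuousAt.continuousWithinAt)
      continuousOn_id fun y hy => (hpos y hy).ne')
  set m := min 1 z with hm
  have hm0 : 0 < m := lt_min one_pos hz
  have hle : ∀ y ∈ Set.uIoc 1 z, m ≤ y := fun y hy => (Set.uIoc_subset_uIcc hy).1
  -- remainders
  set e : ℝ → ℝ → ℝ := fun T y =>
    (momentPrimitive (coshIntegral T) y - momentPrimitive G y) / y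
      - sinh T / cosh T * (sin (y * cosh T) / (y ^ 2 * cosh T)) with he
  have hei : ∀ T, IntervalIntegrable (e T) volume 1 z := fun T => by
    refine ContinuousOn.intervalIntegrable (ContinuousOn.sub (ContinuousOn.div
      (ContinuousOn.sub (fun y hy => ?_) fun y hy => ?_) continuousOn_id fun y hy =>
        (hpos y hy).ne') (ContinuousOn.mul continuousOn_const (ContinuousOn.div (by fun_prop)
        (by fun_prop) fun y hy => ?_)))
    · exact (hasDerivAt_momentPrimitive (continuous_coshIntegral T).continuousOn
        (hpos y hy)).continuousAt.continuousWithinAt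
    · exact (hasDerivAt_momentPrimitive hGc (hpos y hy)).continuousAt.continuousWithinAt
    · have := hpos y hy
      have := cosh_pos T
      positivity
  have hid : ∀ T, coshFlux T 1 * log z =
      (coshIntegral T z - sinh T / cosh T * (sin (z * cosh T) / (z * cosh T)))
      - (coshIntegral T 1 - sinh T / cosh T * (sin (1 * cosh T) / (1 * cosh T)))
      + ∫ y in (1:ℝ)..z, (momentPrimitive G y / y + e T y) := by
    intro T
    have hli : IntervalIntegrable (fun y => coshFlux T 1 * (1 / y)) volume 1 z :=
      ContinuousOn.intervalIntegrable (continuousOn_const.mul (ContinuousOn.div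
        continuousOn_const continuousOn_id fun y hy => (hpos y hy).ne'))
    have hpt : ∀ y ∈ Set.uIcc 1 z, coshFlux T 1 * (1 / y) - (momentPrimitive G y / y + e T y) =
        coshFlux T y / y + sinh T / cosh T * (sin (y * cosh T) / (y ^ 2 * cosh T)) := by
      intro y hy
      have := hpos y hy
      rw [coshFlux_eq T y]
      simp only [he, momentPrimitive]
      ring
    have h1 := intervalIntegral.integral_eq_sub_of_hasDerivAt (a := 1) (b := z)
      (fun y hy => (hasDerivAt_coshIntegral_sub T (hpos y hy)).congr_deriv (hpt y hy).symm)
      (hli.sub (hNi.add (hei T)))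
    rw [intervalIntegral.integral_sub hli (hNi.add (hei T)), intervalIntegral.integral_const_mul,
      integral_one_div_of_pos one_pos hz, div_one] at h1
    linarith
  have hs0 : ∀ y, 0 < y → Tendsto (fun T => sinh T / cosh T * (sin (y * cosh T) / (y * cosh T)))
      atTop (nhds 0) := by
    intro y hy
    have hlim : Tendsto (fun T => 1 / (y * sinh T)) atTop (nhds 0) :=
      (tendsto_sinh_atTop.const_mul_atTop hy).const_div_atTop 1
    refine squeeze_zero_norm' ?_ hlim
    filter_upwards [eventually_gt_atTop 0] with T hT
    have hs := sinh_pos_iff.2 hT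
    have hc := cosh_pos T
    rw [norm_mul, norm_div (sin _), Real.norm_eq_abs, Real.norm_eq_abs, Real.norm_eq_abs,
      abs_of_pos (a := y * cosh T) (by positivity)]
    refine (mul_le_of_le_one_left (by positivity) (abs_sinh_div_cosh_le T)).trans ?_
    gcongr
    · exact abs_sin_le_one _
    · exact (sinh_lt_cosh T).le
  have hei0 : Tendsto (fun T => ∫ y in (1:ℝ)..z, e T y) atTop (nhds 0) := by
    have hlim : Tendsto (fun T => (2 * |z - 1| / m + 1 / m ^ 2) / sinh T * |z - 1|) atTop
        (nhds 0) := by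
      simpa only [zero_mul] using
        (tendsto_sinh_atTop.const_div_atTop (2 * |z - 1| / m + 1 / m ^ 2)).mul_const |z - 1|
    refine squeeze_zero_norm' ?_ hlim
    filter_upwards [eventually_gt_atTop 0] with T hT
    have hs := sinh_pos_iff.2 hT
    have hc := cosh_pos T
    refine intervalIntegral.norm_integral_le_of_norm_le_const fun y hy => ?_
    have hy0 : 0 < y := hpos y (Set.uIoc_subset_uIcc hy)
    have hmy := hle y hy
    have h1 : |momentPrimitive (coshIntegral T) y - momentPrimitive G y| ≤
        2 / sinh T * |z - 1| := by
      rw [momentPrimitive, momentPrimitive,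
        ← intervalIntegral.integral_sub (hTi T 1 y) (hGi y hy0), ← Real.norm_eq_abs]
      refine (intervalIntegral.norm_integral_le_of_norm_le_const (C := 2 / sinh T)
        fun x hx => ?_).trans ?_
      · have hx0 : 0 < x := uIcc_one_subset hy0 (Set.uIoc_subset_uIcc hx)
        rw [← mul_sub, norm_mul, Real.norm_eq_abs, Real.norm_eq_abs, abs_of_pos hx0]
        calc _ ≤ x * (2 / (x * sinh T)) := by
              gcongr; exact abs_coshIntegral_sub_le hG hT hx0
          _ = _ := by field_simp
      · gcongr 2 / sinh T * ?_
        exact Set.abs_sub_left_of_mem_uIcc (Set.uIoc_subset_uIcc hy)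
    have h2 : |sinh T / cosh T * (sin (y * cosh T) / (y ^ 2 * cosh T))| ≤
        1 / (m ^ 2 * sinh T) := by
      rw [abs_mul, abs_div (sin _), abs_of_pos (a := y ^ 2 * cosh T) (by positivity)]
      refine (mul_le_of_le_one_left (by positivity) (abs_sinh_div_cosh_le T)).trans ?_
      gcongr
      · exact abs_sin_le_one _
      · exact (sinh_lt_cosh T).le
    simp only [he]
    refine (norm_sub_le _ _).trans ?_
    rw [norm_div, Real.norm_eq_abs, Real.norm_eq_abs, Real.norm_eq_abs, abs_of_pos hy0]
    calc _ ≤ 2 / sinh T * |z - 1| / m + 1 / (m ^ 2 * sinh T) := by gcongr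
      _ = _ := by field_simp
  have hid' : (fun T => coshFlux T 1 * log z) = fun T =>
      (coshIntegral T z - sinh T / cosh T * (sin (z * cosh T) / (z * cosh T)))
      - (coshIntegral T 1 - sinh T / cosh T * (sin (1 * cosh T) / (1 * cosh T)))
      + ((∫ y in (1:ℝ)..z, momentPrimitive G y / y) + ∫ y in (1:ℝ)..z, e T y) := by
    funext T
    rw [hid T, intervalIntegral.integral_add hNi (hei T)]
  rw [hid']
  have := (((hG z hz).sub (hs0 z hz)).sub ((hG 1 one_pos).sub (hs0 1 one_pos))).add
    (hei0.const_add (∫ y in (1:ℝ)..z, momentPrimitive G y / y))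
  simpa only [sub_zero, add_zero] using this

/-- The improper integral `∫₀^∞ cos (z cosh t) dt` solves Bessel's equation. -/
lemma exists_isBesselSolution_of_tendsto
    (hG : ∀ z, 0 < z → Tendsto (fun T => coshIntegral T z) atTop (nhds (G z))) :
    ∃ A, IsBesselSolution G A := by
  have hGc := continuousOn_of_tendsto_coshIntegral hG
  obtain ⟨β, hβ⟩ : ∃ β, Tendsto (fun T => coshFlux T 1) atTop (nhds β) :=
    ⟨_, by simpa using tendsto_coshFlux_mul_log hG (exp_pos 1)⟩
  have hrep : ∀ z, 0 < z →
      G z = G 1 + β * log z - ∫ y in (1:ℝ)..z, momentPrimitive G y / y := fun z hz => by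
    have := tendsto_nhds_unique (tendsto_coshFlux_mul_log hG hz) (hβ.mul_const (log z))
    linarith
  have hNc : ContinuousOn (fun y => momentPrimitive G y / y) (Set.Ioi 0) :=
    ContinuousOn.div (fun y hy =>
      (hasDerivAt_momentPrimitive hGc hy).continuousAt.continuousWithinAt)
      continuousOn_id fun y hy => (Set.mem_Ioi.1 hy).ne'
  refine ⟨fun z => (β - momentPrimitive G z) / z, fun z hz => ⟨?_, ?_⟩⟩
  · have h1 : HasDerivAt (fun z => G 1 + β * log z - ∫ y in (1:ℝ)..z, momentPrimitive G y / y)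
        (β * z⁻¹ - momentPrimitive G z / z) z :=
      (((hasDerivAt_log hz.ne').const_mul β).const_add (G 1)).sub
        (intervalIntegral.integral_hasDerivAt_right
          (hNc.mono (uIcc_one_subset hz)).intervalIntegrable
          (hNc.stronglyMeasurableAtFilter isOpen_Ioi _ hz) (hNc.continuousAt (Ioi_mem_nhds hz)))
    refine (h1.congr_of_eventuallyEq ?_).congr_deriv (by field_simp)
    filter_upwards [Ioi_mem_nhds hz] with y hy using hrep y hy
  · refine HasDerivAt.congr_deriv (((hasDerivAt_momentPrimitive hGc hz).const_sub β).div
      (hasDerivAt_id z) hz.ne') ?_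
    field_simp
    ring

end

namespace IsBesselSolution

variable {w A : ℝ → ℝ}

lemma hasDerivAt_second (h : IsBesselSolution w A) {y : ℝ} (hy : 0 < y) :
    HasDerivAt (fun y => -(A y) / y - w y) (A y / y ^ 2 - (-(A y) / y - w y) / y - A y) y := by
  obtain ⟨h1, h2⟩ := h y hy
  refine HasDerivAt.congr_deriv ((h2.neg.div (hasDerivAt_id y) hy.ne').sub h1) ?_
  simp only [id_eq, Pi.neg_apply]
  field_simp
  ring

lemma hasDerivAt_comp_mul (h : IsBesselSolution w A) {s x : ℝ} (hs : 0 < s) (hx : 0 < x) :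
    HasDerivAt (fun x => A (s * x)) (s * (-(A (s * x)) / (s * x) - w (s * x))) x := by
  have := (h (s * x) (by positivity)).2.comp x ((hasDerivAt_id x).const_mul s)
  exact this.congr_deriv (by ring)

lemma hasDerivAt_second_comp_mul (h : IsBesselSolution w A) {s x : ℝ} (hs : 0 < s) (hx : 0 < x) :
    HasDerivAt (fun x => s * (-(A (s * x)) / (s * x) - w (s * x)))
      (A (s * x) / x ^ 2 - s * (-(A (s * x)) / (s * x) - w (s * x)) / x - s ^ 2 * A (s * x)) x := by
  have := ((h.hasDerivAt_second (y := s * x) (by positivity)).comp x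
    ((hasDerivAt_id x).const_mul s)).const_mul s
  refine this.congr_deriv ?_
  field_simp

/-- Green's identity for the order-one Bessel operator on `[ε, 1]`. -/
lemma green (h : IsBesselSolution w A) {r ε : ℝ} (hr : 0 < r) (hε : 0 < ε) (hε1 : ε ≤ 1)
    {g g₁ g₂ : ℝ → ℝ} (hg : ∀ x ∈ Set.Icc ε 1, HasDerivAt g (g₁ x) x)
    (hg₁ : ∀ x ∈ Set.Icc ε 1, HasDerivAt g₁ (g₂ x) x) (hg₂ : ContinuousOn g₂ (Set.Icc ε 1))
    (hg1 : g 1 = 0) (hg₁1 : g₁ 1 = 0) :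
    ∫ x in ε..1, x * A (r * x) * (g₂ x + g₁ x / x - g x / x ^ 2 + r ^ 2 * g x) =
      ε * (r * (-(A (r * ε)) / (r * ε) - w (r * ε)) * g ε - A (r * ε) * g₁ ε) := by
  have hpos : ∀ x ∈ Set.Icc ε 1, 0 < x := fun x hx => hε.trans_le hx.1
  have hc : ContinuousOn
      (fun x => x * A (r * x) * (g₂ x + g₁ x / x - g x / x ^ 2 + r ^ 2 * g x)) (Set.Icc ε 1) := by
    have c0 : ContinuousOn g (Set.Icc ε 1) := fun x hx => (hg x hx).continuousAt.continuousWithinAt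
    have c1 : ContinuousOn g₁ (Set.Icc ε 1) :=
      fun x hx => (hg₁ x hx).continuousAt.continuousWithinAt
    have cA : ContinuousOn (fun x => A (r * x)) (Set.Icc ε 1) :=
      fun x hx => (h.hasDerivAt_comp_mul hr (hpos x hx)).continuousAt.continuousWithinAt
    exact (continuousOn_id.mul cA).mul (((hg₂.add (c1.div continuousOn_id
      fun x hx => (hpos x hx).ne')).sub (c0.div (continuousOn_id.pow 2)
      fun x hx => (pow_pos (hpos x hx) 2).ne')).add (continuousOn_const.mul c0))
  have := intervalIntegral.integral_eq_sub_of_hasDerivAt (a := ε) (b := 1)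
    (f := fun x => -(x * (r * (-(A (r * x)) / (r * x) - w (r * x)) * g x - A (r * x) * g₁ x)))
    (f' := fun x => x * A (r * x) * (g₂ x + g₁ x / x - g x / x ^ 2 + r ^ 2 * g x)) ?_ ?_
  · rw [this]
    simp only [hg1, hg₁1]
    ring
  · intro x hx
    rw [Set.uIcc_of_le hε1] at hx
    have hx0 := hpos x hx
    refine HasDerivAt.congr_deriv ((hasDerivAt_id x).mul
      (((h.hasDerivAt_second_comp_mul hr hx0).mul (hg x hx)).sub
        ((h.hasDerivAt_comp_mul hr hx0).mul (hg₁ x hx)))).neg ?_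
    simp only [id_eq, Pi.sub_apply, Pi.mul_apply]
    field_simp
    ring
  · rw [← Set.uIcc_of_le hε1] at hc
    exact hc.intervalIntegrable

end IsBesselSolution

/-- A cutoff near the origin: `D 0` equals `1` on `[0, c]`, vanishes near `1` and beyond, and
`D k` is its `k`-th derivative. -/
structure IsCutoff (c : ℝ) (D : ℕ → ℝ → ℝ) : Prop where
  pos : 0 < c
  lt_one : c < 1
  hasDerivAt : ∀ k x, HasDerivAt (D k) (D (k + 1) x) x
  eq_one : ∀ x ∈ Set.Icc 0 c, D 0 x = 1
  abs_le_one : ∀ x, |D 0 x| ≤ 1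
  eq_zero : ∀ k x, 1 ≤ x → D k x = 0
  eq_zero_of_lt : ∀ k, k ≠ 0 → ∀ x, 0 < x → x < c → D k x = 0

namespace IsCutoff

variable {c : ℝ} {D : ℕ → ℝ → ℝ}

lemma continuous (hD : IsCutoff c D) (k : ℕ) : Continuous (D k) :=
  continuous_iff_continuousAt.2 fun x => (hD.hasDerivAt k x).continuousAt

lemma exists_bound (hD : IsCutoff c D) : ∃ K, 0 < K ∧ ∀ x ∈ Set.Icc c 1,
    |2 * D 1 x| ≤ K ∧ |D 2 x + D 1 x / x| ≤ K ∧
    |D 4 x + D 3 x / x - 2 * D 2 x / x ^ 2 + 2 * D 1 x / x ^ 3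
      + (D 3 x + D 2 x / x - D 1 x / x ^ 2) / x - 4 * D 1 x / x ^ 3 + 4 * D 2 x / x ^ 2| ≤ K ∧
    |-(D 2 x + D 1 x / x) - 4 * D 2 x| ≤ K ∧
    |2 * (D 3 x + D 2 x / x - D 1 x / x ^ 2) + 2 * D 1 x / x ^ 2 + 2 * D 3 x - 2 * D 2 x / x|
      ≤ K := by
  have hpos : ∀ x ∈ Set.Icc c 1, x ≠ 0 := fun x hx => (hD.pos.trans_le hx.1).ne'
  have hd : ∀ k n (a : ℝ), ContinuousOn (fun x => a * D k x / x ^ n) (Set.Icc c 1) := fun k n a =>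
    ((hD.continuous k).const_mul a |>.continuousOn).div (continuousOn_id.pow n)
      fun x hx => pow_ne_zero n (hpos x hx)
  have key : ∀ f : ℝ → ℝ, ContinuousOn f (Set.Icc c 1) → ∃ K, ∀ x ∈ Set.Icc c 1, |f x| ≤ K :=
    fun f hf => isCompact_Icc.exists_bound_of_continuousOn hf
  have h := fun k n => hd k n 1
  simp only [one_mul] at h
  have h0 := fun k => h k 0
  have h1 := fun k => h k 1
  have h2 := fun k a => hd k 0 a
  simp only [pow_zero, div_one, pow_one] at h0 h1 h2
  obtain ⟨K1, hK1⟩ := key _ (h2 1 2)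
  obtain ⟨K2, hK2⟩ := key _ ((h0 2).add (h1 1))
  obtain ⟨K3, hK3⟩ := key _ (((((((h0 4).add (h1 3)).sub (hd 2 2 2)).add (hd 1 3 2)).add
    ((((h0 3).add (h1 2)).sub (h 1 2)).div continuousOn_id hpos)).sub (hd 1 3 4)).add (hd 2 2 4))
  obtain ⟨K4, hK4⟩ := key _ ((((h0 2).add (h1 1)).neg).sub (h2 2 4))
  have h3 : ContinuousOn (fun x => 2 * D 2 x / x) (Set.Icc c 1) := by simpa using hd 2 1 2
  obtain ⟨K5, hK5⟩ := key _ (((((((h0 3).add (h1 2)).sub (h 1 2)).const_mul 2).add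
    (hd 1 2 2)).add (h2 3 2)).sub h3)
  refine ⟨max 1 (max K1 (max K2 (max K3 (max K4 K5)))), by positivity, fun x hx => ?_⟩
  simp only [le_max_iff]
  exact ⟨.inr (.inl (hK1 x hx)), .inr (.inr (.inl (hK2 x hx))),
    .inr (.inr (.inr (.inl (hK3 x hx)))), .inr (.inr (.inr (.inr (.inl (hK4 x hx))))),
    .inr (.inr (.inr (.inr (.inr (hK5 x hx)))))⟩

end IsCutoff

lemma abs_integral_le_of_eq_zero_of_lt {c ε M : ℝ} {f : ℝ → ℝ} (hε : 0 < ε) (hε1 : ε ≤ 1)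
    (hM : 0 ≤ M) (h0 : ∀ x, 0 < x → x < c → f x = 0) (h1 : ∀ x ∈ Set.Icc c 1, |f x| ≤ M) :
    |∫ x in ε..1, f x| ≤ M := by
  refine (intervalIntegral.norm_integral_le_of_norm_le_const (C := M) (f := f) fun x hx => ?_).trans ?_
  · rw [Set.uIoc_of_le hε1] at hx
    rcases lt_or_ge x c with hc | hc
    · rw [h0 x (hε.trans hx.1) hc, norm_zero]
      exact hM
    · exact h1 x ⟨hc, hx.2⟩
  · rw [abs_of_nonneg (by linarith)]
    nlinarith

namespace IsBesselSolution

variable {w A v v₁ : ℝ → ℝ} {c r s ε U V K : ℝ} {D : ℕ → ℝ → ℝ}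

lemma integral_cutoff_eq (h : IsBesselSolution w A) (hD : IsCutoff c D) (hr : 0 < r)
    (hε : 0 < ε) (hεc : ε < c)
    (hv : ∀ x, 0 < x → HasDerivAt v (v₁ x) x)
    (hv₁ : ∀ x, 0 < x → HasDerivAt v₁ (v x / x ^ 2 - v₁ x / x - s ^ 2 * v x) x) :
    (r ^ 2 - s ^ 2) * (∫ x in ε..1, x * A (r * x) * (D 0 x * v x)) =
      ε * (r * (-(A (r * ε)) / (r * ε) - w (r * ε)) * v ε - A (r * ε) * v₁ ε)
      - ∫ x in ε..1, x * A (r * x) * (2 * D 1 x * v₁ x + (D 2 x + D 1 x / x) * v x) := by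
  have hε1 : ε ≤ 1 := (hεc.trans hD.lt_one).le
  have hpos : ∀ x ∈ Set.Icc ε 1, 0 < x := fun x hx => hε.trans_le hx.1
  have cD : ∀ k, ContinuousOn (D k) (Set.Icc ε 1) := fun k => (hD.continuous k).continuousOn
  have cv : ContinuousOn v (Set.Icc ε 1) :=
    fun x hx => (hv x (hpos x hx)).continuousAt.continuousWithinAt
  have cv₁ : ContinuousOn v₁ (Set.Icc ε 1) :=
    fun x hx => (hv₁ x (hpos x hx)).continuousAt.continuousWithinAt
  have cx : ContinuousOn (fun x : ℝ => x) (Set.Icc ε 1) := continuousOn_id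
  have cA : ContinuousOn (fun x => A (r * x)) (Set.Icc ε 1) :=
    fun x hx => (h.hasDerivAt_comp_mul hr (hpos x hx)).continuousAt.continuousWithinAt
  have hne : ∀ x ∈ Set.Icc ε 1, x ≠ 0 := fun x hx => (hpos x hx).ne'
  have hne2 : ∀ x ∈ Set.Icc ε 1, x ^ 2 ≠ 0 := fun x hx => pow_ne_zero 2 (hne x hx)
  have hgreen := h.green hr hε hε1 (g := fun x => D 0 x * v x)
    (g₁ := fun x => D 1 x * v x + D 0 x * v₁ x)
    (g₂ := fun x => D 2 x * v x + 2 * (D 1 x * v₁ x)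
      + D 0 x * (v x / x ^ 2 - v₁ x / x - s ^ 2 * v x))
    (fun x hx => (hD.hasDerivAt 0 x).mul (hv x (hpos x hx)))
    (fun x hx => HasDerivAt.congr_deriv (((hD.hasDerivAt 1 x).mul (hv x (hpos x hx))).add
      ((hD.hasDerivAt 0 x).mul (hv₁ x (hpos x hx)))) (by ring))
    ((((cD 2).mul cv).add (((cD 1).mul cv₁).const_mul 2)).add ((cD 0).mul
      (((cv.div (cx.pow 2) hne2).sub (cv₁.div cx hne)).sub (cv.const_mul (s ^ 2)))))
    (by simp [hD.eq_zero]) (by simp [hD.eq_zero])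
  have i1 : IntervalIntegrable (fun x => x * A (r * x) * (D 0 x * v x)) volume ε 1 := by
    apply ContinuousOn.intervalIntegrable
    rw [Set.uIcc_of_le hε1]
    exact (cx.mul cA).mul ((cD 0).mul cv)
  have i2 : IntervalIntegrable (fun x => x * A (r * x) *
      (2 * D 1 x * v₁ x + (D 2 x + D 1 x / x) * v x)) volume ε 1 := by
    apply ContinuousOn.intervalIntegrable
    rw [Set.uIcc_of_le hε1]
    exact (cx.mul cA).mul ((((cD 1).const_mul 2).mul cv₁).add
      (((cD 2).add ((cD 1).div cx hne)).mul cv))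
  rw [hD.eq_one ε ⟨hε.le, hεc.le⟩, hD.eq_zero_of_lt 1 one_ne_zero ε hε hεc] at hgreen
  simp only [one_mul, zero_mul, zero_add] at hgreen
  rw [← hgreen, ← intervalIntegral.integral_const_mul, eq_sub_iff_add_eq,
    ← intervalIntegral.integral_add (i1.const_mul _) i2]
  refine intervalIntegral.integral_congr fun x hx => ?_
  rw [Set.uIcc_of_le hε1] at hx
  have := hpos x hx
  field_simp
  ring

lemma abs_integral_error_le (h : IsBesselSolution w A) (hD : IsCutoff c D) (hr : 0 < r)
    (hε : 0 < ε) (hεc : ε < c)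
    (hv : ∀ x, 0 < x → HasDerivAt v (v₁ x) x)
    (hv₁ : ∀ x, 0 < x → HasDerivAt v₁ (v x / x ^ 2 - v₁ x / x - s ^ 2 * v x) x)
    (hU : ∀ x ∈ Set.Icc c 1, |A (r * x)| ≤ U) (hV : ∀ x ∈ Set.Icc c 1, |v x| ≤ V)
    (hV₁ : ∀ x ∈ Set.Icc c 1, |v₁ x| ≤ V)
    (hK : ∀ x ∈ Set.Icc c 1, |2 * D 1 x| ≤ K ∧ |D 2 x + D 1 x / x| ≤ K ∧
      |D 4 x + D 3 x / x - 2 * D 2 x / x ^ 2 + 2 * D 1 x / x ^ 3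
        + (D 3 x + D 2 x / x - D 1 x / x ^ 2) / x - 4 * D 1 x / x ^ 3 + 4 * D 2 x / x ^ 2| ≤ K ∧
      |-(D 2 x + D 1 x / x) - 4 * D 2 x| ≤ K ∧
      |2 * (D 3 x + D 2 x / x - D 1 x / x ^ 2) + 2 * D 1 x / x ^ 2 + 2 * D 3 x - 2 * D 2 x / x|
        ≤ K) :
    |∫ x in ε..1, x * A (r * x) * (2 * D 1 x * v₁ x + (D 2 x + D 1 x / x) * v x)|
        ≤ 2 * U * K * V ∧
    r ^ 2 * |∫ x in ε..1, x * A (r * x) * (2 * D 1 x * v₁ x + (D 2 x + D 1 x / x) * v x)|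
        ≤ 2 * U * K * V * (1 + s ^ 2) := by
  have hε1 : ε ≤ 1 := (hεc.trans hD.lt_one).le
  have hc1 : (1:ℝ) ∈ Set.Icc c 1 := ⟨hD.lt_one.le, le_rfl⟩
  have hU0 : 0 ≤ U := (abs_nonneg _).trans (hU 1 hc1)
  have hV0 : 0 ≤ V := (abs_nonneg _).trans (hV 1 hc1)
  have hK0 : 0 ≤ K := (abs_nonneg _).trans (hK 1 hc1).1
  have hpos : ∀ x ∈ Set.Icc ε 1, 0 < x := fun x hx => hε.trans_le hx.1
  have hz : ∀ k, k ≠ 0 → ∀ x, 0 < x → x < c → D k x = 0 := hD.eq_zero_of_lt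
  have hprod : ∀ x ∈ Set.Icc c 1, ∀ y M, |y| ≤ M → |x * A (r * x) * y| ≤ U * M := by
    intro x hx y M hy
    have hx0 : 0 < x := hD.pos.trans_le hx.1
    rw [abs_mul, abs_mul, abs_of_pos hx0]
    exact mul_le_mul ((mul_le_of_le_one_left (abs_nonneg _) hx.2).trans (hU x hx)) hy
      (abs_nonneg _) hU0
  refine ⟨abs_integral_le_of_eq_zero_of_lt (c := c) hε hε1 (by positivity) (fun x hx hxc => ?_)
    fun x hx => ?_, ?_⟩
  · simp [hz 1 one_ne_zero x hx hxc, hz 2 two_ne_zero x hx hxc]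
  · obtain ⟨k1, k2, -⟩ := hK x hx
    refine (hprod x hx _ (K * V + K * V) ((abs_add_le _ _).trans ?_)).trans_eq (by ring)
    rw [abs_mul _ (v₁ x), abs_mul _ (v x)]
    exact add_le_add (mul_le_mul k1 (hV₁ x hx) (abs_nonneg _) hK0)
      (mul_le_mul k2 (hV x hx) (abs_nonneg _) hK0)
  · set c1 : ℝ → ℝ := fun x => D 4 x + D 3 x / x - 2 * D 2 x / x ^ 2 + 2 * D 1 x / x ^ 3
      + (D 3 x + D 2 x / x - D 1 x / x ^ 2) / x - 4 * D 1 x / x ^ 3 + 4 * D 2 x / x ^ 2 with hc1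
    set c2 : ℝ → ℝ := fun x => -(D 2 x + D 1 x / x) - 4 * D 2 x with hc2
    set c3 : ℝ → ℝ := fun x => 2 * (D 3 x + D 2 x / x - D 1 x / x ^ 2) + 2 * D 1 x / x ^ 2
      + 2 * D 3 x - 2 * D 2 x / x with hc3
    have cD : ∀ k, ContinuousOn (D k) (Set.Icc ε 1) := fun k => (hD.continuous k).continuousOn
    have cv : ContinuousOn v (Set.Icc ε 1) :=
      fun x hx => (hv x (hpos x hx)).continuousAt.continuousWithinAt
    have cv₁ : ContinuousOn v₁ (Set.Icc ε 1) :=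
      fun x hx => (hv₁ x (hpos x hx)).continuousAt.continuousWithinAt
    have cx : ContinuousOn (fun x : ℝ => x) (Set.Icc ε 1) := continuousOn_id
    have cA : ContinuousOn (fun x => A (r * x)) (Set.Icc ε 1) :=
      fun x hx => (h.hasDerivAt_comp_mul hr (hpos x hx)).continuousAt.continuousWithinAt
    have hne : ∀ n, ∀ x ∈ Set.Icc ε 1, x ^ n ≠ 0 := fun n x hx => pow_ne_zero n (hpos x hx).ne'
    have hne1 : ∀ x ∈ Set.Icc ε 1, x ≠ 0 := fun x hx => (hpos x hx).ne'
    -- the amplitude and its first two derivatives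
    set g₁ : ℝ → ℝ := fun x => 2 * D 2 x * v₁ x + 2 * D 1 x * (v x / x ^ 2 - v₁ x / x - s ^ 2 * v x)
      + ((D 3 x + D 2 x / x - D 1 x / x ^ 2) * v x + (D 2 x + D 1 x / x) * v₁ x) with hg₁
    set g₂ : ℝ → ℝ := fun x => c1 x * v x + s ^ 2 * (c2 x * v x) + c3 x * v₁ x
      - s ^ 2 * (2 * D 1 x * v₁ x) - g₁ x / x
      + (2 * D 1 x * v₁ x + (D 2 x + D 1 x / x) * v x) / x ^ 2 with hg₂
    have dD : ∀ x ∈ Set.Icc ε 1, HasDerivAt (fun x => D 2 x + D 1 x / x)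
        (D 3 x + D 2 x / x - D 1 x / x ^ 2) x := fun x hx => by
      have := hpos x hx
      refine HasDerivAt.congr_deriv ((hD.hasDerivAt 2 x).add
        ((hD.hasDerivAt 1 x).div (hasDerivAt_id x) this.ne')) ?_
      field_simp
      ring
    have dD2 : ∀ x ∈ Set.Icc ε 1, HasDerivAt (fun x => D 3 x + D 2 x / x - D 1 x / x ^ 2)
        (D 4 x + D 3 x / x - 2 * D 2 x / x ^ 2 + 2 * D 1 x / x ^ 3) x := fun x hx => by
      have := hpos x hx
      refine HasDerivAt.congr_deriv (((hD.hasDerivAt 3 x).add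
        ((hD.hasDerivAt 2 x).div (hasDerivAt_id x) this.ne')).sub
        ((hD.hasDerivAt 1 x).div ((hasDerivAt_id x).pow 2) (hne 2 x hx))) ?_
      simp only [id_eq]
      field_simp
      ring
    have cc : ∀ k n, ContinuousOn (fun x => D k x / x ^ n) (Set.Icc ε 1) := fun k n =>
      (cD k).div (cx.pow n) (hne n)
    have cc1 : ∀ k, ContinuousOn (fun x => D k x / x) (Set.Icc ε 1) := fun k =>
      (cD k).div cx hne1
    have cc2 : ∀ k n (a : ℝ), ContinuousOn (fun x => a * D k x / x ^ n) (Set.Icc ε 1) :=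
      fun k n a => ((cD k).const_mul a).div (cx.pow n) (hne n)
    have cc3 : ∀ k (a : ℝ), ContinuousOn (fun x => a * D k x / x) (Set.Icc ε 1) :=
      fun k a => ((cD k).const_mul a).div cx hne1
    have cc4 : ContinuousOn (fun x => D 3 x + D 2 x / x - D 1 x / x ^ 2) (Set.Icc ε 1) :=
      ((cD 3).add (cc1 2)).sub (cc 1 2)
    have cc5 : ContinuousOn (fun x => D 2 x + D 1 x / x) (Set.Icc ε 1) := (cD 2).add (cc1 1)
    have k1 : ContinuousOn c1 (Set.Icc ε 1) := ((((((cD 4).add (cc1 3)).sub (cc2 2 2 2)).add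
      (cc2 1 3 2)).add (cc4.div cx hne1)).sub (cc2 1 3 4)).add (cc2 2 2 4)
    have k2 : ContinuousOn c2 (Set.Icc ε 1) := cc5.neg.sub ((cD 2).const_mul 4)
    have k3 : ContinuousOn c3 (Set.Icc ε 1) :=
      (((cc4.const_mul 2).add (cc2 1 2 2)).add ((cD 3).const_mul 2)).sub (cc3 2 2)
    have cg : ContinuousOn (fun x => 2 * D 1 x * v₁ x + (D 2 x + D 1 x / x) * v x)
        (Set.Icc ε 1) := (((cD 1).const_mul 2).mul cv₁).add (cc5.mul cv)
    have hd1 : ∀ x ∈ Set.Icc ε 1, HasDerivAt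
        (fun x => 2 * D 1 x * v₁ x + (D 2 x + D 1 x / x) * v x) (g₁ x) x := fun x hx =>
      ((((hD.hasDerivAt 1 x).const_mul 2).mul (hv₁ x (hpos x hx))).add
        ((dD x hx).mul (hv x (hpos x hx))))
    have hd2 : ∀ x ∈ Set.Icc ε 1, HasDerivAt g₁ (g₂ x) x := fun x hx => by
      have hx0 := hpos x hx
      have e0 := hv x hx0
      have e1 := hv₁ x hx0
      have e2 := ((e0.div ((hasDerivAt_id x).pow 2) (hne 2 x hx)).sub
        (e1.div (hasDerivAt_id x) hx0.ne')).sub (e0.const_mul (s ^ 2))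
      refine HasDerivAt.congr_deriv ((((((hD.hasDerivAt 2 x).const_mul 2).mul e1).add
        (((hD.hasDerivAt 1 x).const_mul 2).mul e2)).add
        (((dD2 x hx).mul e0).add ((dD x hx).mul e1)))) ?_
      simp only [hg₂, hg₁, hc1, hc2, hc3, id_eq, Pi.pow_apply]
      simp
      field_simp
      ring
    have cg₁ : ContinuousOn g₁ (Set.Icc ε 1) :=
      fun x hx => (hd2 x hx).continuousAt.continuousWithinAt
    have cg₂ : ContinuousOn g₂ (Set.Icc ε 1) :=
      (((((k1.mul cv).add ((k2.mul cv).const_mul _)).add (k3.mul cv₁)).sub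
        ((((cD 1).const_mul 2).mul cv₁).const_mul _)).sub (cg₁.div cx hne1)).add
        (cg.div (cx.pow 2) (hne 2))
    have hgreen := h.green hr hε hε1 hd1 hd2 cg₂ (by simp [hD.eq_zero]) (by simp [hg₁, hD.eq_zero])
    have z1 := hz 1 one_ne_zero ε hε hεc
    have z2 := hz 2 two_ne_zero ε hε hεc
    have z3 := hz 3 three_ne_zero ε hε hεc
    have hzero : ε * (r * (-(A (r * ε)) / (r * ε) - w (r * ε)) *
        (2 * D 1 ε * v₁ ε + (D 2 ε + D 1 ε / ε) * v ε) - A (r * ε) * g₁ ε) = 0 := by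
      simp [hg₁, z1, z2, z3]
    rw [hzero] at hgreen
    have i1 : IntervalIntegrable (fun x => x * A (r * x) *
        (2 * D 1 x * v₁ x + (D 2 x + D 1 x / x) * v x)) volume ε 1 := by
      apply ContinuousOn.intervalIntegrable
      rw [Set.uIcc_of_le hε1]
      exact (cx.mul cA).mul cg
    have i2 : IntervalIntegrable (fun x => x * A (r * x) *
        (c1 x * v x + s ^ 2 * (c2 x * v x) + c3 x * v₁ x - s ^ 2 * (2 * D 1 x * v₁ x)))
        volume ε 1 := by
      apply ContinuousOn.intervalIntegrable
      rw [Set.uIcc_of_le hε1]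
      exact (cx.mul cA).mul ((((k1.mul cv).add ((k2.mul cv).const_mul _)).add (k3.mul cv₁)).sub
        ((((cD 1).const_mul 2).mul cv₁).const_mul _))
    have hsum : r ^ 2 * (∫ x in ε..1, x * A (r * x) *
        (2 * D 1 x * v₁ x + (D 2 x + D 1 x / x) * v x)) = -∫ x in ε..1, x * A (r * x) *
        (c1 x * v x + s ^ 2 * (c2 x * v x) + c3 x * v₁ x - s ^ 2 * (2 * D 1 x * v₁ x)) := by
      rw [eq_neg_iff_add_eq_zero, ← hgreen, ← intervalIntegral.integral_const_mul,
        ← intervalIntegral.integral_add (i1.const_mul _) i2]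
      refine intervalIntegral.integral_congr fun x hx => ?_
      simp only [hg₂]
      ring
    rw [← abs_of_nonneg (sq_nonneg r), ← abs_mul, hsum, abs_neg]
    refine abs_integral_le_of_eq_zero_of_lt (c := c) hε hε1 (by positivity) (fun x hx hxc => ?_)
      fun x hx => ?_
    · simp [hc1, hc2, hc3, hz 1 one_ne_zero x hx hxc, hz 2 two_ne_zero x hx hxc,
        hz 3 three_ne_zero x hx hxc, hz 4 four_ne_zero x hx hxc]
    · obtain ⟨b1, -, b2, b3, b4⟩ := hK x hx
      have m : ∀ a b : ℝ, |a| ≤ K → |b| ≤ V → |a * b| ≤ K * V := fun a b ha hb => by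
        rw [abs_mul]
        exact mul_le_mul ha hb (abs_nonneg _) hK0
      have p1 := abs_le.1 (m _ _ b2 (hV x hx))
      have p2 := abs_le.1 (m _ _ b3 (hV x hx))
      have p3 := abs_le.1 (m _ _ b4 (hV₁ x hx))
      have p4 := abs_le.1 (m _ _ b1 (hV₁ x hx))
      refine (hprod x hx _ (2 * K * V * (1 + s ^ 2)) (abs_le.2 ⟨?_, ?_⟩)).trans_eq (by ring)
      · linarith [mul_le_mul_of_nonneg_left p2.1 (sq_nonneg s),
          mul_le_mul_of_nonneg_left p4.2 (sq_nonneg s)]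
      · linarith [mul_le_mul_of_nonneg_left p2.2 (sq_nonneg s),
          mul_le_mul_of_nonneg_left p4.1 (sq_nonneg s)]

end IsBesselSolution

lemma le_two_mul_of_sqrt_bounds {r s X M : ℝ} (hr : 0 < r) (hs : 0 < s) (hM : 0 ≤ M)
    (h1 : X ≤ M * (√(1 + r) / √(1 + s)))
    (h2 : r ^ 2 * X ≤ M * (√(1 + r) / √(1 + s)) * (1 + s ^ 2)) : X ≤ 2 * M := by
  rcases le_total r (1 + s) with hrs | hrs
  · refine h1.trans ?_
    rw [mul_comm 2 M]
    gcongr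
    rw [div_le_iff₀ (by positivity)]
    apply sqrt_le_iff.2 ⟨by positivity, ?_⟩
    rw [mul_pow, sq_sqrt (by positivity)]
    linarith
  · have h3 : √(1 + r) / √(1 + s) ≤ (1 + r) / (1 + s) := by
      rw [← sqrt_div (by positivity)]
      apply sqrt_le_iff.2 ⟨by positivity, ?_⟩
      exact le_self_pow₀ ((one_le_div (by positivity)).2 (by linarith)) two_ne_zero
    have h4 : (1 + r) / (1 + s) * (1 + s ^ 2) ≤ 2 * r ^ 2 := by
      rw [div_mul_eq_mul_div, div_le_iff₀ (by positivity)]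
      nlinarith [mul_nonneg (sub_nonneg.2 hrs) hs.le, mul_nonneg (sub_nonneg.2 hrs) hr.le,
        mul_pos hr hs]
    have h5 : r ^ 2 * X ≤ r ^ 2 * (2 * M) := by
      calc r ^ 2 * X ≤ M * (√(1 + r) / √(1 + s)) * (1 + s ^ 2) := h2
        _ ≤ M * ((1 + r) / (1 + s)) * (1 + s ^ 2) := by gcongr
        _ = M * ((1 + r) / (1 + s) * (1 + s ^ 2)) := by ring
        _ ≤ M * (2 * r ^ 2) := by gcongr
        _ = _ := by ring
    exact le_of_mul_le_mul_left h5 (by positivity)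

lemma div_le_div_sqrt_of_bounds {r s X M : ℝ} (hr : 0 < r) (hs : 0 < s) (hM : 0 ≤ M)
    (h1 : |r ^ 2 - s ^ 2| * X ≤ M * (s / r)) (h2 : r ≤ 1 + s → X ≤ M * (s / r) / (1 + s)) :
    X ≤ 4 * M * s / (r * √(1 + (r + s) ^ 2) * √(1 + (r - s) ^ 2)) := by
  have hsum : √(1 + (r + s) ^ 2) ≤ 1 + r + s := sqrt_le_iff.2 ⟨by positivity, by nlinarith⟩
  have hMs : 0 ≤ M * (s / r) := by positivity
  suffices h : X * (√(1 + (r + s) ^ 2) * √(1 + (r - s) ^ 2)) ≤ 4 * (M * (s / r)) by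
    rw [mul_assoc r, ← div_div, le_div_iff₀ (by positivity)]
    exact h.trans_eq (by ring)
  rcases le_or_gt X 0 with hX | hX
  · exact (mul_nonpos_of_nonpos_of_nonneg hX (by positivity)).trans (by positivity)
  rcases le_total |r - s| 1 with hd | hd
  · have hd' := abs_le.1 hd
    have hdiff : √(1 + (r - s) ^ 2) ≤ 2 := sqrt_le_iff.2 ⟨by norm_num, by nlinarith⟩
    have h3 := h2 (by linarith)
    rw [le_div_iff₀ (by positivity)] at h3
    calc _ ≤ X * ((1 + r + s) * 2) := by gcongr
      _ ≤ X * (2 * (1 + s) * 2) := by gcongr; linarith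
      _ = 4 * (X * (1 + s)) := by ring
      _ ≤ _ := by gcongr
  · have hdiff : √(1 + (r - s) ^ 2) ≤ 2 * |r - s| :=
      sqrt_le_iff.2 ⟨by positivity, by nlinarith [sq_abs (r - s)]⟩
    have h3 : 1 ≤ r + s := hd.trans (abs_sub_le_iff.2 ⟨by linarith, by linarith⟩)
    calc _ ≤ X * ((2 * (r + s)) * (2 * |r - s|)) := by gcongr; linarith
      _ = 4 * (|r ^ 2 - s ^ 2| * X) := by
        rw [show r ^ 2 - s ^ 2 = (r + s) * (r - s) by ring, abs_mul,
          abs_of_pos (a := r + s) (by linarith)]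
        ring
      _ ≤ _ := by gcongr

namespace IsBesselSolution

variable {w A : ℝ → ℝ} {c : ℝ} {D : ℕ → ℝ → ℝ}

/-- The integrand of the oscillatory integral. -/
noncomputable def integrand (A : ℝ → ℝ) (φ : ℝ → ℝ) (r s l : ℝ) : ℝ :=
  l * A (r * l) * (φ l * J0deriv (s * l))

lemma continuousOn_integrand (h : IsBesselSolution w A) {φ : ℝ → ℝ} (hφ : Continuous φ) {r s : ℝ}
    (hr : 0 < r) : ContinuousOn (integrand A φ r s) (Set.Ioi 0) := by
  have hJ : Continuous J0deriv :=
    continuous_iff_continuousAt.2 fun z => (hasDerivAt_J0deriv z).continuousAt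
  have cA : ContinuousOn (fun x => A (r * x)) (Set.Ioi 0) :=
    fun x hx => (h.hasDerivAt_comp_mul hr hx).continuousAt.continuousWithinAt
  exact (continuousOn_id.mul cA).mul
    (hφ.mul (hJ.comp (continuous_const.mul continuous_id))).continuousOn

lemma exists_bound_integral_ge (h : IsBesselSolution w A) (hD : IsCutoff c D) :
    ∃ C, 0 < C ∧ ∀ r s ε, 0 < r → 0 < s → 0 < ε → ε < c → r * ε ≤ 1 →
      |r ^ 2 - s ^ 2| * |∫ l in ε..1, integrand A (D 0) r s l| ≤ C * (s / r) := by
  obtain ⟨K₁, hK₁, hA, hw, -⟩ := h.exists_bound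
  obtain ⟨K₂, hK₂, hB, hB'⟩ := exists_bound_J0deriv
  obtain ⟨K₃, hK₃, hK⟩ := hD.exists_bound
  have hc := hD.pos
  refine ⟨5 * K₁ + 2 * (2 * K₁ * K₃ * K₂ / (c * √c)), by positivity,
    fun r s ε hr hs hε hεc hrε => ?_⟩
  have hJ2 : ∀ x, 0 < x →
      s * (-(J0deriv (s * x)) / (s * x) - J0 (s * x)) = s * J0deriv2 (s * x) := fun x hx => by
    have := bessel_equation_J0 (s * x)
    field_simp
    linarith
  have heq := h.integral_cutoff_eq hD hr hε hεc
    (fun x hx => isBesselSolution_J0.hasDerivAt_comp_mul hs hx)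
    (fun x hx => isBesselSolution_J0.hasDerivAt_second_comp_mul hs hx)
  have hpos : ∀ x ∈ Set.Icc c 1, 0 < x := fun x hx => hc.trans_le hx.1
  have hsq : ∀ x ∈ Set.Icc c 1, s * (K₂ / √(1 + s * x)) ≤ K₂ * s / (√c * √(1 + s)) := by
    intro x hx
    rw [← mul_div_assoc, mul_comm s, ← sqrt_mul hc.le]
    gcongr
    nlinarith [hx.1, hD.lt_one]
  have herr := h.abs_integral_error_le hD hr hε hεc
    (fun x hx => isBesselSolution_J0.hasDerivAt_comp_mul hs hx)
    (fun x hx => isBesselSolution_J0.hasDerivAt_second_comp_mul hs hx)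
    (U := K₁ * (√(1 + r) / (r * c))) (V := K₂ * s / (√c * √(1 + s))) (K := K₃)
    (fun x hx => by
      have := hpos x hx
      refine (hA _ (by positivity)).trans ?_
      gcongr
      · nlinarith [hx.2]
      · exact hx.1)
    (fun x hx => by
      have hx0 := hpos x hx
      refine (hB _ (by positivity)).trans (le_trans ?_ (hsq x hx))
      have : s * x / ((1 + s * x) * √(1 + s * x)) ≤ s / √(1 + s * x) := by
        rw [div_le_div_iff₀ (by positivity) (by positivity), ← mul_assoc]
        gcongr
        nlinarith [hx.2, mul_pos hs hx0]
      calc _ ≤ K₂ * (s / √(1 + s * x)) := by gcongr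
        _ = _ := by ring)
    (fun x hx => by
      have hx0 := hpos x hx
      rw [hJ2 x hx0, abs_mul, abs_of_pos hs]
      refine le_trans ?_ (hsq x hx)
      gcongr
      exact hB' _ (by positivity)) hK
  set E := ∫ x in ε..1, x * A (r * x) * (2 * D 1 x *
    (s * (-(J0deriv (s * x)) / (s * x) - J0 (s * x))) + (D 2 x + D 1 x / x) * J0deriv (s * x))
  have hM : 2 * (K₁ * (√(1 + r) / (r * c))) * K₃ * (K₂ * s / (√c * √(1 + s))) =
      2 * K₁ * K₃ * K₂ / (c * √c) * (s / r) * (√(1 + r) / √(1 + s)) := by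
    field_simp
  rw [hM] at herr
  have hE : |E| ≤ 2 * (2 * K₁ * K₃ * K₂ / (c * √c) * (s / r)) :=
    le_two_mul_of_sqrt_bounds hr hs (by positivity) herr.1 herr.2
  have hrε0 : 0 < r * ε := by positivity
  have hAε : |A (r * ε)| ≤ 2 * K₁ / (r * ε) := by
    refine (hA _ hrε0).trans ?_
    rw [← mul_div_assoc, mul_comm 2]
    gcongr
    exact sqrt_le_iff.2 ⟨by norm_num, by linarith⟩
  have hA'ε : |-(A (r * ε)) / (r * ε) - w (r * ε)| ≤ 3 * K₁ / (r * ε) ^ 2 := by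
    have h1 : |-(A (r * ε)) / (r * ε)| ≤ 2 * K₁ / (r * ε) / (r * ε) := by
      rw [abs_div, abs_neg, abs_of_pos hrε0]
      gcongr
    have h2 : |w (r * ε)| ≤ K₁ / (r * ε) ^ 2 := by
      refine (hw _ hrε0 hrε).trans ?_
      gcongr
      nlinarith
    calc _ ≤ 2 * K₁ / (r * ε) / (r * ε) + K₁ / (r * ε) ^ 2 :=
          (abs_sub _ _).trans (add_le_add h1 h2)
      _ = _ := by field_simp; ring
  have hbd : |ε * (r * (-(A (r * ε)) / (r * ε) - w (r * ε)) * J0deriv (s * ε)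
      - A (r * ε) * (s * (-(J0deriv (s * ε)) / (s * ε) - J0 (s * ε))))| ≤ 5 * K₁ * (s / r) := by
    rw [hJ2 ε hε, abs_mul, abs_of_pos hε]
    have h1 : |r * (-(A (r * ε)) / (r * ε) - w (r * ε)) * J0deriv (s * ε)| ≤
        r * (3 * K₁ / (r * ε) ^ 2) * (s * ε) := by
      rw [abs_mul, abs_mul, abs_of_pos hr]
      gcongr
      exact (abs_J0deriv_le _).trans_eq (abs_of_pos (by positivity))
    have h2 : |A (r * ε) * (s * J0deriv2 (s * ε))| ≤ 2 * K₁ / (r * ε) * (s * 1) := by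
      rw [abs_mul, abs_mul, abs_of_pos hs]
      gcongr
      exact abs_J0deriv2_le _
    calc _ ≤ ε * (r * (3 * K₁ / (r * ε) ^ 2) * (s * ε) + 2 * K₁ / (r * ε) * (s * 1)) := by
          gcongr
          exact (abs_sub _ _).trans (add_le_add h1 h2)
      _ = _ := by field_simp; ring
  rw [← abs_mul]
  unfold integrand
  rw [heq]
  calc _ ≤ 5 * K₁ * (s / r) + 2 * (2 * K₁ * K₃ * K₂ / (c * √c) * (s / r)) :=
        (abs_sub _ _).trans (add_le_add hbd hE)
    _ = _ := by ring

lemma exists_bound_integrand (h : IsBesselSolution w A) (hD : IsCutoff c D) :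
    ∃ C, 0 < C ∧ ∀ r s l, 0 < r → 0 < s → 0 < l → l ≤ 1 →
      |integrand A (D 0) r s l| ≤ C * (s / r) * √(1 + r) ∧
      (r ≤ 1 + s → |integrand A (D 0) r s l| ≤ C * (s / r) / (1 + s)) := by
  obtain ⟨K₁, hK₁, hA, -⟩ := h.exists_bound
  obtain ⟨K₂, hK₂, hB, -⟩ := exists_bound_J0deriv
  refine ⟨2 * (K₁ * K₂), by positivity, fun r s l hr hs hl hl1 => ?_⟩
  have hq : 1 ≤ √(1 + s * l) := one_le_sqrt.2 (by nlinarith [mul_pos hs hl])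
  have hmain : |integrand A (D 0) r s l| ≤
      K₁ * K₂ * (s / r) * (√(1 + r * l) / √(1 + s * l)) * (l / (1 + s * l)) := by
    rw [integrand, abs_mul, abs_mul, abs_mul, abs_of_pos hl]
    calc _ ≤ l * (K₁ * (√(1 + r * l) / (r * l))) *
          (1 * (K₂ * (s * l / ((1 + s * l) * √(1 + s * l))))) := by
          gcongr
          · exact hA _ (by positivity)
          · exact hD.abs_le_one l
          · exact hB _ (by positivity)
      _ = _ := by field_simp
  constructor
  · refine hmain.trans ?_
    have h1 : √(1 + r * l) / √(1 + s * l) ≤ √(1 + r) :=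
      (div_le_self (by positivity) hq).trans (sqrt_le_sqrt (by nlinarith))
    have h2 : l / (1 + s * l) ≤ 1 := by
      rw [div_le_one (by positivity)]
      nlinarith [mul_pos hs hl]
    calc _ ≤ K₁ * K₂ * (s / r) * √(1 + r) * 1 := by gcongr
      _ ≤ 2 * (K₁ * K₂ * (s / r) * √(1 + r) * 1) := le_mul_of_one_le_left (by positivity) one_le_two
      _ = _ := by ring
  · intro hrs
    refine hmain.trans ?_
    have h1 : √(1 + r * l) / √(1 + s * l) ≤ 2 := by
      rw [div_le_iff₀ (by positivity)]
      apply sqrt_le_iff.2 ⟨by positivity, ?_⟩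
      rw [mul_pow, sq_sqrt (by positivity)]
      nlinarith [mul_pos hs hl, mul_nonneg (sub_nonneg.2 hrs) hl.le]
    have h2 : l / (1 + s * l) ≤ 1 / (1 + s) := by
      rw [div_le_div_iff₀ (by positivity) (by positivity)]
      linarith
    calc _ ≤ K₁ * K₂ * (s / r) * 2 * (1 / (1 + s)) := by gcongr
      _ = _ := by ring

lemma integrand_eq_zero (hD : IsCutoff c D) {r s l : ℝ} (hl : 1 ≤ l) :
    integrand A (D 0) r s l = 0 := by
  simp [integrand, hD.eq_zero 0 l hl]

lemma integrableOn_integrand (h : IsBesselSolution w A) (hD : IsCutoff c D) {r s : ℝ}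
    (hr : 0 < r) (hs : 0 < s) : IntegrableOn (integrand A (D 0) r s) (Set.Ioi 0) := by
  obtain ⟨C, -, hC⟩ := h.exists_bound_integrand hD
  have hcont := h.continuousOn_integrand (s := s) (hD.continuous 0) hr
  have h1 : IntegrableOn (integrand A (D 0) r s) (Set.Ioc 0 1) :=
    Integrable.of_bound
      ((hcont.mono Set.Ioc_subset_Ioi_self).aestronglyMeasurable measurableSet_Ioc)
      (C * (s / r) * √(1 + r))
      ((ae_restrict_iff' measurableSet_Ioc).2 (.of_forall fun l hl => (hC r s l hr hs hl.1 hl.2).1))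
  exact h1.of_forall_sdiff_eq_zero measurableSet_Ioi fun l hl =>
    integrand_eq_zero hD (le_of_not_ge fun hl' => hl.2 ⟨hl.1, hl'⟩)

lemma exists_bound_integral (h : IsBesselSolution w A) (hD : IsCutoff c D) :
    ∃ C, 0 < C ∧ ∀ r s, 0 < r → 0 < s →
      |∫ l in Set.Ioi (0:ℝ), integrand A (D 0) r s l| ≤
        C * s / (r * √(1 + (r + s) ^ 2) * √(1 + (r - s) ^ 2)) := by
  obtain ⟨C₁, hC₁, hbound⟩ := h.exists_bound_integral_ge hD
  obtain ⟨C₂, hC₂, hpt⟩ := h.exists_bound_integrand hD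
  refine ⟨4 * (C₁ + C₂), by positivity, fun r s hr hs => ?_⟩
  have hI : ∫ l in Set.Ioi (0:ℝ), integrand A (D 0) r s l =
      ∫ l in (0:ℝ)..1, integrand A (D 0) r s l := by
    rw [intervalIntegral.integral_of_le zero_le_one]
    refine setIntegral_eq_of_subset_of_forall_sdiff_eq_zero measurableSet_Ioi
      Set.Ioc_subset_Ioi_self fun l hl =>
        integrand_eq_zero hD (le_of_not_ge fun hl' => hl.2 ⟨hl.1, hl'⟩)
  have hii : ∀ a b, 0 ≤ a → 0 ≤ b → IntervalIntegrable (integrand A (D 0) r s) volume a b :=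
    fun a b ha hb => intervalIntegrable_iff.2 ((h.integrableOn_integrand hD hr hs).mono_set
      fun x hx => lt_of_le_of_lt (le_min ha hb) hx.1)
  rw [hI]
  refine div_le_div_sqrt_of_bounds hr hs (by positivity) ?_ fun hrs => ?_
  · have hc := hD.pos
    have hc1 := hD.lt_one
    set Q := 1 + r + (r ^ 2 + s ^ 2) * √(1 + r) with hQ
    have hQ0 : 0 ≤ (r ^ 2 + s ^ 2) * √(1 + r) := by positivity
    have hQ1 : 1 ≤ Q := by linarith
    set ε := c / (2 * Q) with hεdef
    have hε : 0 < ε := by positivity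
    have hεQ : ε * Q = c / 2 := by rw [hεdef]; field_simp
    have hεc : ε < c := by nlinarith
    have hrε : r * ε ≤ 1 := by nlinarith
    have hε2 : (r ^ 2 + s ^ 2) * √(1 + r) * ε ≤ 1 := by nlinarith
    rw [← intervalIntegral.integral_add_adjacent_intervals (hii 0 ε le_rfl hε.le)
      (hii ε 1 hε.le zero_le_one)]
    have h1 : |∫ l in (0:ℝ)..ε, integrand A (D 0) r s l| ≤ C₂ * (s / r) * √(1 + r) * ε := by
      refine (intervalIntegral.norm_integral_le_of_norm_le_const (f := integrand A (D 0) r s)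
        (C := C₂ * (s / r) * √(1 + r)) fun l hl => ?_).trans_eq
        (by rw [sub_zero, abs_of_pos hε])
      rw [Set.uIoc_of_le hε.le] at hl
      exact (hpt r s l hr hs hl.1 (by linarith [hl.2])).1
    have h2 : |r ^ 2 - s ^ 2| ≤ r ^ 2 + s ^ 2 :=
      abs_le.2 ⟨by nlinarith [sq_nonneg r], by nlinarith [sq_nonneg s]⟩
    calc _ ≤ |r ^ 2 - s ^ 2| * (|∫ l in (0:ℝ)..ε, integrand A (D 0) r s l|
          + |∫ l in ε..1, integrand A (D 0) r s l|) := by gcongr; exact abs_add_le _ _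
      _ = |r ^ 2 - s ^ 2| * |∫ l in (0:ℝ)..ε, integrand A (D 0) r s l|
          + |r ^ 2 - s ^ 2| * |∫ l in ε..1, integrand A (D 0) r s l| := mul_add _ _ _
      _ ≤ (r ^ 2 + s ^ 2) * (C₂ * (s / r) * √(1 + r) * ε) + C₁ * (s / r) := by
        exact add_le_add (mul_le_mul h2 h1 (abs_nonneg _) (by positivity))
          (hbound r s ε hr hs hε hεc hrε)
      _ = C₂ * (s / r) * ((r ^ 2 + s ^ 2) * √(1 + r) * ε) + C₁ * (s / r) := by ring
      _ ≤ C₂ * (s / r) * 1 + C₁ * (s / r) := by gcongr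
      _ = _ := by ring
  · refine (intervalIntegral.norm_integral_le_of_norm_le_const (f := integrand A (D 0) r s)
      (C := C₂ * (s / r) / (1 + s)) fun l hl => ?_).trans ?_
    · rw [Set.uIoc_of_le zero_le_one] at hl
      exact (hpt r s l hr hs hl.1 hl.2).2 hrs
    · rw [sub_zero, abs_one, mul_one]
      gcongr
      linarith

end IsBesselSolution

lemma isCutoff_iteratedDeriv {lam₁ : ℝ} (hlam₁ : lam₁ ∈ Set.Ioc (0:ℝ) (1/4))
    {χ : ℝ → ℝ} (hχ : ContDiff ℝ (⊤ : ℕ∞) χ) (hχ01 : ∀ t, χ t ∈ Set.Icc (0:ℝ) 1)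
    (hχ1 : ∀ t ∈ Set.Icc (0:ℝ) lam₁, χ t = 1) (hχ0 : ∀ t : ℝ, 2 * lam₁ ≤ t → χ t = 0) :
    IsCutoff lam₁ (fun k => iteratedDeriv k χ) where
  pos := hlam₁.1
  lt_one := by linarith [hlam₁.2]
  hasDerivAt k x := by
    rw [iteratedDeriv_succ]
    exact ((hχ.differentiable_iteratedDeriv k (by exact_mod_cast WithTop.coe_lt_top _)) x).hasDerivAt
  eq_one := by simpa using hχ1
  abs_le_one x := by
    rw [iteratedDeriv_zero, abs_of_nonneg (hχ01 x).1]
    exact (hχ01 x).2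
  eq_zero k x hx := by
    have : χ =ᶠ[nhds x] fun _ => 0 := by
      filter_upwards [Ioi_mem_nhds (show 2 * lam₁ < x by linarith [hlam₁.2])] with y hy
      exact hχ0 y (le_of_lt hy)
    rw [this.iteratedDeriv_eq k]
    simp
  eq_zero_of_lt k hk x hx hxc := by
    have : χ =ᶠ[nhds x] fun _ => 1 := by
      filter_upwards [Ioo_mem_nhds hx hxc] with y hy
      exact hχ1 y ⟨hy.1.le, hy.2.le⟩
    rw [this.iteratedDeriv_eq k]
    simp [iteratedDeriv_const, hk]

/-- the oscillatory integral bound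
`|∫₀^∞ (H₀⁻)′(λr) J₀′(λs) λ χ(λ) dλ| ≲ s (1 + log⟨r⟩) / (r ⟨r+s⟩ ⟨r-s⟩)`.
Here `Y0` is the Bessel function of the second kind of order zero, characterized by
the improper-integral representation `Y₀(z) = -(2/π) ∫₀^∞ cos(z cosh t) dt` for `z > 0`,
and `H0m = J₀ - i Y₀` on `(0,∞)` is the Hankel function of order zero. -/
theorem stmt_5
    (Y0 : ℝ → ℝ)
    (hY0 : ∀ z : ℝ, 0 < z →
      Tendsto (fun T : ℝ => ∫ t in (0:ℝ)..T, Real.cos (z * Real.cosh t)) atTop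
        (nhds (-(Real.pi / 2) * Y0 z)))
    (H0m : ℝ → ℂ)
    (hH0m : ∀ z : ℝ, 0 < z → H0m z = (J0 z : ℂ) - Complex.I * (Y0 z : ℂ))
    (lam₁ : ℝ) (hlam₁ : lam₁ ∈ Set.Ioc (0:ℝ) (1/4))
    (χ : ℝ → ℝ) (hχ : ContDiff ℝ (⊤ : ℕ∞) χ)
    (hχ01 : ∀ t, χ t ∈ Set.Icc (0:ℝ) 1)
    (hχ1 : ∀ t ∈ Set.Icc (0:ℝ) lam₁, χ t = 1)
    (hχ0 : ∀ t : ℝ, 2 * lam₁ ≤ t → χ t = 0) :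
    ∃ C : ℝ, 0 < C ∧ ∀ r s : ℝ, 0 < r → 0 < s →
      ‖∫ l in Set.Ioi (0:ℝ),
          deriv H0m (l * r) * (Complex.ofReal (deriv J0 (l * s))) * (l : ℂ) *
            (χ l : ℂ)‖ ≤
        C * s * (1 + Real.log (Real.sqrt (1 + r ^ 2))) /
          (r * Real.sqrt (1 + (r + s) ^ 2) * Real.sqrt (1 + (r - s) ^ 2)) := by
  have hD := isCutoff_iteratedDeriv hlam₁ hχ hχ01 hχ1 hχ0
  obtain ⟨A, hA⟩ := exists_isBesselSolution_of_tendsto (G := fun z => -(π / 2) * Y0 z) hY0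
  have hY : ∀ z, 0 < z → HasDerivAt Y0 (-(2 / π) * A z) z := fun z hz => by
    have := (hA z hz).1.const_mul (-(2 / π))
    refine this.congr_of_eventuallyEq (.of_forall fun y => ?_)
    simp only
    field_simp
  have hH : ∀ z, 0 < z →
      deriv H0m z = (J0deriv z : ℂ) + Complex.I * (2 / π) * (A z : ℂ) := fun z hz => by
    have h1 : HasDerivAt (fun z => (J0 z : ℂ) - Complex.I * (Y0 z : ℂ))
        ((J0deriv z : ℂ) - Complex.I * ((-(2 / π) * A z : ℝ) : ℂ)) z :=
      (hasDerivAt_J0 z).ofReal_comp.sub ((hY z hz).ofReal_comp.const_mul Complex.I)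
    have h2 := h1.congr_of_eventuallyEq (f₁ := H0m) (by
      filter_upwards [Ioi_mem_nhds hz] with y hy using hH0m y hy)
    rw [h2.deriv]
    push_cast
    ring
  obtain ⟨C₁, hC₁, h₁⟩ := isBesselSolution_J0.exists_bound_integral hD
  obtain ⟨C₂, hC₂, h₂⟩ := hA.exists_bound_integral hD
  refine ⟨C₁ + C₂, by positivity, fun r s hr hs => ?_⟩
  have i₁ := isBesselSolution_J0.integrableOn_integrand hD hr hs
  have i₂ := hA.integrableOn_integrand hD hr hs
  specialize h₁ r s hr hs
  specialize h₂ r s hr hs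
  set F₁ := IsBesselSolution.integrand J0deriv (iteratedDeriv 0 χ) r s with hF₁
  set F₂ := IsBesselSolution.integrand A (iteratedDeriv 0 χ) r s with hF₂
  have heq : ∫ l in Set.Ioi (0:ℝ), deriv H0m (l * r) * (Complex.ofReal (deriv J0 (l * s))) *
      (l : ℂ) * (χ l : ℂ) =
      ((∫ l in Set.Ioi (0:ℝ), F₁ l : ℝ) : ℂ)
        + Complex.I * (2 / π) * ((∫ l in Set.Ioi (0:ℝ), F₂ l : ℝ) : ℂ) := by
    rw [← integral_complex_ofReal, ← integral_complex_ofReal, ← integral_const_mul,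
      ← integral_add i₁.ofReal (i₂.ofReal.const_mul _)]
    refine setIntegral_congr_fun measurableSet_Ioi fun l (hl : 0 < l) => ?_
    simp only [hF₁, hF₂, IsBesselSolution.integrand, iteratedDeriv_zero]
    rw [hH _ (by positivity), (hasDerivAt_J0 _).deriv, mul_comm l r, mul_comm l s]
    push_cast
    ring
  rw [heq]
  have hlog : 0 ≤ log (√(1 + r ^ 2)) := log_nonneg (one_le_sqrt.2 (by nlinarith))
  set R := r * √(1 + (r + s) ^ 2) * √(1 + (r - s) ^ 2)
  have hR : 0 < R := by positivity
  have hπ : ‖Complex.I * (2 / π)‖ ≤ 1 := by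
    rw [norm_mul, Complex.norm_I, one_mul, norm_div, Complex.norm_real, Complex.norm_ofNat,
      Real.norm_eq_abs, abs_of_pos pi_pos, div_le_one pi_pos]
    exact two_le_pi
  calc _ ≤ C₁ * s / R + 1 * (C₂ * s / R) := by
        refine (norm_add_le _ _).trans ?_
        rw [norm_mul _ (Complex.ofReal _), Complex.norm_real, Complex.norm_real, Real.norm_eq_abs,
          Real.norm_eq_abs]
        gcongr
    _ = (C₁ + C₂) * s * 1 / R := by ring
    _ ≤ _ := by gcongr; linarith
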